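/- For every RBW-contraction 𝔠 : T → T' of S-labeled RBW-trees, the maximal length of a chain in the poset 𝒫_𝔠 of nontrivial intermediate contractions is codim(𝔠) − 1, where the length of a chain C is |C| − 1 (so the empty chain has length −1). -/

import Mathlib

/-- The three colors for vertices of RBW-trees. -/
inductive RBW : Type
  | R | B | W
deriving DecidableEq

/-- `RBW.legalPair d a` : the pair (descendant color `d`, ancestor color `a`) is legal. -/
def RBW.legalPair : RBW → RBW → Prop
  | .R, _ => True
  | .W, .B => True
  | .B, .B => True
  | _, _ => False

/-- A finite rooted tree whose vertices carry pairwise disjoint label sets covering `S`,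
with every vertex having (#children + #labels) ≥ 2. -/
structure LTree (S : Type) : Type 1 where
  V : Type
  fintypeV : Fintype V
  root : V
  parent : V → V
  parent_root : parent root = root
  reaches_root : ∀ v, ∃ n, parent^[n] v = root
  label : V → Set S
  label_disjoint : ∀ v w, v ≠ w → Disjoint (label v) (label w)
  label_cover : ∀ s : S, ∃ v, s ∈ label v
  arity : ∀ v, 2 ≤ {w | parent w = v ∧ w ≠ root}.ncard + (label v).ncard

attribute [instance] LTree.fintypeV

namespace LTree

variable {S : Type} (T : LTree S)

/-- `T.ancOrEq v w` : `v` is an ancestor of `w` or equal to `w`. -/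
def ancOrEq (v w : T.V) : Prop := ∃ n, T.parent^[n] w = v

/-- `T.strictAnc v w` : `v` is a strict ancestor of `w`. -/
def strictAnc (v w : T.V) : Prop := T.ancOrEq v w ∧ v ≠ w

/-- A vertex is a leaf if it has no children. -/
def IsLeaf (v : T.V) : Prop := ∀ w, T.parent w = v → w = T.root

/-- `F` is a subtree (connected subset) of `T` with root `r`. -/
def IsSubtreeRooted (F : Set T.V) (r : T.V) : Prop :=
  r ∈ F ∧ (∀ w ∈ F, T.ancOrEq r w) ∧ ∀ w ∈ F, w = r ∨ T.parent w ∈ F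

end LTree

/-- An `S`-labeled RBW-tree: a labeled tree with a legal `{R,B,W}`-coloring (along every
path from a leaf to the root, the colors are `R`s, then at most one `W`, then `B`s). -/
structure RBWTree (S : Type) extends LTree S where
  color : V → RBW
  legal : ∀ v w, toLTree.strictAnc w v → RBW.legalPair (color v) (color w)

/-- An RBW-contraction from `T` to `T'`: a surjection on vertices whose fibers are
connected subtrees, compatible with the parent relation, roots and labels, such that the
preimage of an `R`- (resp. `B`-) colored vertex consists of `R`- (resp. `B`-) colored
vertices. -/
structure Contr {S : Type} (T T' : RBWTree S) : Type where
  toFun : T.V → T'.V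
  surj : Function.Surjective toFun
  root_eq : toFun T.root = T'.root
  parent_compat : ∀ v, toFun (T.parent v) = toFun v ∨ toFun (T.parent v) = T'.parent (toFun v)
  fiber_subtree : ∀ v' : T'.V, ∃ r, toFun r = v' ∧
      (∀ w, toFun w = v' → T.toLTree.ancOrEq r w) ∧
      (∀ w, toFun w = v' → w = r ∨ toFun (T.parent w) = v')
  label_eq : ∀ v', T'.label v' = ⋃ w ∈ {w | toFun w = v'}, T.label w
  color_back : ∀ v, (T'.color (toFun v) = RBW.R → T.color v = RBW.R) ∧
      (T'.color (toFun v) = RBW.B → T.color v = RBW.B)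

/-- The data underlying a contraction out of `T`: the "same fiber" relation together
with the induced coloring of the vertices (the color of the image vertex). -/
def ContrData {S : Type} (T : RBWTree S) : Type := (T.V → T.V → Prop) × (T.V → RBW)

namespace ContrData

variable {S : Type} {T : RBWTree S}

/-- `q ≤ q'` : `q'` is a further contraction of `q` (fibers coarser, colors compatibly
changed); this is the order of the poset `𝒯^{RBW}(S)` expressed on contraction data. -/
instance : LE (ContrData T) :=
  ⟨fun q q' => (∀ v w, q.1 v w → q'.1 v w) ∧
    ∀ v, (q'.2 v = RBW.R → q.2 v = RBW.R) ∧ (q'.2 v = RBW.B → q.2 v = RBW.B)⟩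

/-- Data of the trivial (identity) contraction. -/
def bot (T : RBWTree S) : ContrData T := (Eq, T.color)

/-- Data of the contraction of all of `T` to a single vertex of color `η`. -/
def top (T : RBWTree S) (η : RBW) : ContrData T := (fun _ _ => True, fun _ => η)

end ContrData

/-- The data associated to a contraction. -/
def Contr.data {S : Type} {T T' : RBWTree S} (c : Contr T T') : ContrData T :=
  (fun v w => c.toFun v = c.toFun w, fun v => T'.color (c.toFun v))

/-- `q` is realizable if it is the data of an actual RBW-contraction out of `T`. -/
def ContrData.Realizable {S : Type} {T : RBWTree S} (q : ContrData T) : Prop :=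
  ∃ (T' : RBWTree S) (c : Contr T T'), c.data = q

/-- The half-open interval `(T, q₀]`: the poset of nontrivial contractions out of `T`
which are intermediate for a contraction with data `q₀` (identifying a contraction with
its data, i.e. identifying isomorphic targets). -/
abbrev Pcal {S : Type} {T : RBWTree S} (q₀ : ContrData T) : Type :=
  {q : ContrData T // q.Realizable ∧ q ≠ ContrData.bot T ∧ q ≤ q₀}

/-- The poset `𝒫_T` of all nontrivial contractions out of `T` (the interval `(T, •_W]`). -/
abbrev PT {S : Type} (T : RBWTree S) : Type := Pcal (ContrData.top T RBW.W)

/-- `∂𝒫_T` : the poset of nontrivial contractions out of `T` with the maximal one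
(the contraction to `•_W`) removed. -/
abbrev PBd {S : Type} (T : RBWTree S) : Type :=
  {q : ContrData T // q.Realizable ∧ q ≠ ContrData.bot T ∧ q ≠ ContrData.top T RBW.W}

/-- `Codim T` : the number of vertices of `T` colored `R` or `B`. -/
noncomputable def RBWTree.codim {S : Type} (T : RBWTree S) : ℕ := {v : T.V | T.color v ≠ RBW.W}.ncard

namespace LTree

variable {S : Type} {T : LTree S} {u v w : T.V}

lemma ancOrEq_refl (v : T.V) : T.ancOrEq v v := ⟨0, rfl⟩

lemma ancOrEq_parent (v : T.V) : T.ancOrEq (T.parent v) v := ⟨1, rfl⟩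

lemma ancOrEq.trans (h : T.ancOrEq u v) (h' : T.ancOrEq v w) : T.ancOrEq u w := by
  obtain ⟨n, rfl⟩ := h
  obtain ⟨m, rfl⟩ := h'
  exact ⟨n + m, Function.iterate_add_apply _ _ _ _⟩

lemma iterate_parent_root (n : ℕ) : T.parent^[n] T.root = T.root :=
  Function.iterate_fixed T.parent_root n

lemma eq_root_of_ancOrEq_root (h : T.ancOrEq v T.root) : v = T.root := by
  obtain ⟨n, rfl⟩ := h
  exact iterate_parent_root n

lemma eq_root_of_ancOrEq_parent (h : T.ancOrEq v (T.parent v)) : v = T.root := by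
  obtain ⟨n, hn⟩ := h
  obtain ⟨m, hm⟩ := T.reaches_root v
  have hper : Function.IsPeriodicPt T.parent (n + 1) v := hn
  have h1 : T.parent^[(n + 1) * m] v = v := hper.mul_const m
  have h2 : T.parent^[n * m + m] v = T.root := by
    rw [Function.iterate_add_apply, hm, iterate_parent_root]
  rw [← h1, add_one_mul, h2]

lemma parent_ne_self (h : v ≠ T.root) : T.parent v ≠ v := fun h' =>
  h (eq_root_of_ancOrEq_parent (by rw [h']; exact ancOrEq_refl v))

lemma strictAnc_parent (h : v ≠ T.root) : T.strictAnc (T.parent v) v :=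
  ⟨ancOrEq_parent v, parent_ne_self h⟩

lemma strictAnc.ne_root (h : T.strictAnc w v) : v ≠ T.root := by
  rintro rfl
  exact h.2 (eq_root_of_ancOrEq_root h.1)

lemma strictAnc.ancOrEq_parent (h : T.strictAnc w v) : T.ancOrEq w (T.parent v) := by
  obtain ⟨⟨n, hn⟩, hne⟩ := h
  cases n with
  | zero => exact absurd hn.symm hne
  | succ n => exact ⟨n, hn⟩

lemma ancOrEq.eq_or_strictAnc (h : T.ancOrEq w v) : v = w ∨ T.strictAnc w v := by
  by_cases hvw : v = w
  · exact Or.inl hvw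
  · exact Or.inr ⟨h, fun h' => hvw h'.symm⟩

lemma strictAnc.exists_child (h : T.strictAnc u v) :
    ∃ k, T.parent k = u ∧ k ≠ T.root ∧ T.ancOrEq k v := by
  obtain ⟨⟨n, hn⟩, hne⟩ := h
  induction n generalizing v with
  | zero => exact absurd hn.symm hne
  | succ n ih =>
    by_cases hu : u = T.parent v
    · refine ⟨v, hu.symm, ?_, ancOrEq_refl v⟩
      rintro rfl
      exact hne (hu.trans T.parent_root)
    · obtain ⟨k, hk, hkr, hkv⟩ := ih hu hn
      exact ⟨k, hk, hkr, hkv.trans (LTree.ancOrEq_parent v)⟩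

end LTree

namespace RBW

lemma legalPair.eq_B_of_B {a : RBW} (h : legalPair B a) : a = B := by
  cases a <;> simp_all [legalPair]

lemma legalPair.eq_B_of_W {a : RBW} (h : legalPair W a) : a = B := by
  cases a <;> simp_all [legalPair]

lemma legalPair.eq_R_of_R {d : RBW} (h : legalPair d R) : d = R := by
  cases d <;> simp_all [legalPair]

lemma legalPair.eq_R_of_W {d : RBW} (h : legalPair d W) : d = R := by
  cases d <;> simp_all [legalPair]

end RBW

namespace RBWTree

variable {S : Type} {T : RBWTree S} {v w : T.V}

lemma legal_parent (h : v ≠ T.root) : RBW.legalPair (T.color v) (T.color (T.parent v)) :=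
  T.legal _ _ (LTree.strictAnc_parent h)

lemma color_eq_B_of_strictAnc (hv : v = T.root ∨ T.color (T.parent v) = RBW.B)
    (h : T.toLTree.strictAnc w v) : T.color w = RBW.B := by
  have hp := hv.resolve_left h.ne_root
  rcases h.ancOrEq_parent.eq_or_strictAnc with h' | h'
  · rw [← h', hp]
  · have := T.legal _ _ h'
    rw [hp] at this
    exact this.eq_B_of_B

end RBWTree

namespace Contr

variable {S : Type} {T T₁ T₂ T' : RBWTree S}

/-- The identity contraction. -/
def refl (T : RBWTree S) : Contr T T where
  toFun := id
  surj := Function.surjective_id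
  root_eq := rfl
  parent_compat _ := Or.inr rfl
  fiber_subtree v' := ⟨v', rfl, fun w hw => ⟨0, hw⟩, fun w hw => Or.inl hw⟩
  label_eq v' := by ext; simp
  color_back _ := ⟨id, id⟩

lemma refl_data (T : RBWTree S) : (refl T).data = ContrData.bot T := rfl

lemma map_ancOrEq (c : Contr T T') {v w : T.V} (h : T.toLTree.ancOrEq v w) :
    T'.toLTree.ancOrEq (c.toFun v) (c.toFun w) := by
  obtain ⟨n, hn⟩ := h
  induction n generalizing w with
  | zero => exact ⟨0, by rw [← hn]; rfl⟩
  | succ n ih =>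
    rcases c.parent_compat w with h | h
    · exact h ▸ ih hn
    · exact (ih hn).trans (h ▸ LTree.ancOrEq_parent _)

lemma parent_eq_of_ne (c : Contr T T') {v : T.V} (h : c.toFun v ≠ c.toFun (T.parent v)) :
    T'.parent (c.toFun v) = c.toFun (T.parent v) :=
  ((c.parent_compat v).resolve_left (Ne.symm h)).symm

lemma legal_of_ne (c : Contr T T') {v : T.V} (h : c.toFun v ≠ c.toFun (T.parent v)) :
    RBW.legalPair (T'.color (c.toFun v)) (T'.color (c.toFun (T.parent v))) := by
  refine T'.legal _ _ ?_
  rw [← c.parent_eq_of_ne h]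
  exact ⟨LTree.ancOrEq_parent _, by rw [c.parent_eq_of_ne h]; exact h.symm⟩

lemma parent_mem_fiber (c : Contr T T') {r w : T.V}
    (hr : ∀ w, c.toFun w = c.toFun r → T.toLTree.ancOrEq r w)
    (hp : ∀ w, c.toFun w = c.toFun r → w = r ∨ c.toFun (T.parent w) = c.toFun r)
    (hw : c.toFun w = c.toFun r) (hne : w ≠ r) :
    w ≠ T.root ∧ c.toFun w = c.toFun (T.parent w) := by
  refine ⟨?_, hw.trans ((hp w hw).resolve_left hne).symm⟩
  rintro rfl
  exact hne (LTree.eq_root_of_ancOrEq_root (hr _ hw)).symm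

/-- Composition of contractions. -/
def comp (e : Contr T₁ T₂) (d : Contr T T₁) : Contr T T₂ where
  toFun := e.toFun ∘ d.toFun
  surj := e.surj.comp d.surj
  root_eq := by rw [Function.comp_apply, d.root_eq, e.root_eq]
  parent_compat v := by
    simp only [Function.comp_apply]
    rcases d.parent_compat v with h | h <;> rw [h]
    · exact Or.inl rfl
    · exact e.parent_compat _
  fiber_subtree v' := by
    obtain ⟨r₁, hr₁, h₁, h₁'⟩ := e.fiber_subtree v'
    obtain ⟨r, hr, h, h'⟩ := d.fiber_subtree r₁
    have key : ∀ w, e.toFun (d.toFun w) = v' → w = r ∨ e.toFun (d.toFun (T.parent w)) = v' := by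
      intro w hw
      rcases h₁' _ hw with hx | hx
      · exact (h' w hx).imp id fun h'' => by rw [h'', hr₁]
      · refine Or.inr ?_
        rcases d.parent_compat w with hd | hd <;> rw [hd]
        exacts [hw, hx]
    refine ⟨r, by rw [Function.comp_apply, hr, hr₁], fun w hw => ?_, key⟩
    obtain ⟨n, hn⟩ := T.reaches_root w
    induction n generalizing w with
    | zero =>
      obtain rfl : w = T.root := hn
      refine h _ ?_
      have hw' : e.toFun (d.toFun T.root) = v' := hw
      rw [d.root_eq] at hw' ⊢
      exact (LTree.eq_root_of_ancOrEq_root (h₁ _ hw')).symm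
    | succ n ih =>
      rcases key w hw with rfl | hp
      · exact LTree.ancOrEq_refl _
      · exact (ih _ hp hn).trans (LTree.ancOrEq_parent w)
  label_eq v' := by
    rw [e.label_eq]
    ext s
    simp only [d.label_eq, Set.mem_iUnion, Set.mem_ofPred_eq, Function.comp_apply]
    constructor
    · rintro ⟨x, hx, w, rfl, hs⟩
      exact ⟨w, hx, hs⟩
    · rintro ⟨w, hw, hs⟩
      exact ⟨_, hw, w, rfl, hs⟩
  color_back v := ⟨fun h => (d.color_back v).1 ((e.color_back _).1 h),
    fun h => (d.color_back v).2 ((e.color_back _).2 h)⟩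

/-- Contractions do not increase the codimension along the order, and preserve it only
when they have the same data. -/
lemma codim_le_and_eq (c₁ : Contr T T₁) (c₂ : Contr T T₂) (h : c₁.data ≤ c₂.data) :
    T₂.codim ≤ T₁.codim ∧ (T₁.codim ≤ T₂.codim → c₁.data = c₂.data) := by
  obtain ⟨hrel, hcol⟩ := h
  have hcol₁ : ∀ v, T₂.color (c₂.toFun v) ≠ RBW.W →
      T₂.color (c₂.toFun v) = T₁.color (c₁.toFun v) := by
    intro v hv
    cases hc : T₂.color (c₂.toFun v) with
    | R => exact ((hcol v).1 hc).symm
    | B => exact ((hcol v).2 hc).symm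
    | W => exact absurd hc hv
  choose g hg using c₂.surj
  have hmaps : ∀ y ∈ {y : T₂.V | T₂.color y ≠ RBW.W},
      c₁.toFun (g y) ∈ {x : T₁.V | T₁.color x ≠ RBW.W} := by
    intro y hy
    have := hcol₁ (g y) (by rw [hg]; exact hy)
    rw [Set.mem_ofPred_eq, ← this, hg]
    exact hy
  have hinj : Set.InjOn (fun y => c₁.toFun (g y)) {y : T₂.V | T₂.color y ≠ RBW.W} := by
    intro y _ z _ hyz
    have := hrel _ _ hyz
    change c₂.toFun (g y) = c₂.toFun (g z) at this
    rwa [hg, hg] at this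
  refine ⟨Set.ncard_le_ncard_of_injOn _ hmaps hinj (Set.toFinite _), fun hle => ?_⟩
  have himg : (fun y => c₁.toFun (g y)) '' {y : T₂.V | T₂.color y ≠ RBW.W} =
      {x : T₁.V | T₁.color x ≠ RBW.W} := by
    refine Set.eq_of_subset_of_ncard_le (Set.image_subset_iff.2 hmaps) ?_ (Set.toFinite _)
    rw [hinj.ncard_image]
    exact hle
  have hsection : ∀ v, T₁.color (c₁.toFun v) ≠ RBW.W →
      T₂.color (c₂.toFun v) ≠ RBW.W ∧ c₁.toFun (g (c₂.toFun v)) = c₁.toFun v := by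
    intro v hv
    obtain ⟨y, hy, hyv⟩ := himg.symm.subset hv
    have : c₂.toFun (g y) = c₂.toFun v := hrel _ _ hyv
    rw [hg] at this
    subst this
    exact ⟨hy, hyv⟩
  have hcolor : ∀ v, T₁.color (c₁.toFun v) = T₂.color (c₂.toFun v) := by
    intro v
    by_cases hv : T₁.color (c₁.toFun v) = RBW.W
    · by_contra hne
      have hv₂ : T₂.color (c₂.toFun v) ≠ RBW.W := fun h => hne (hv.trans h.symm)
      exact hne (hcol₁ v hv₂).symm
    · exact (hcol₁ v (hsection v hv).1).symm
  have hfib : ∀ v w, c₂.toFun v = c₂.toFun w → c₁.toFun v = c₁.toFun w := by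
    intro v w hvw
    by_cases hv : T₁.color (c₁.toFun v) = RBW.W
    · obtain ⟨r, hr, hanc, hpar⟩ := c₂.fiber_subtree (c₂.toFun w)
      have hW : ∀ x, c₂.toFun x = c₂.toFun w → T₁.color (c₁.toFun x) = RBW.W := by
        intro x hx
        rw [hcolor, hx, ← hvw, ← hcolor, hv]
      have hroot : ∀ x, c₂.toFun x = c₂.toFun w → c₁.toFun x = c₁.toFun r := by
        intro x hx
        obtain ⟨n, hn⟩ := hanc x hx
        induction n generalizing x with
        | zero => rw [← hn]; rfl
        | succ n ih =>
          rcases hpar x hx with rfl | hp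
          · rfl
          · rw [← ih _ hp hn]
            by_contra hne
            have := c₁.legal_of_ne hne
            rw [hW _ hx, hW _ hp] at this
            exact this
      rw [hroot v hvw, hroot w rfl]
    · have hw : T₁.color (c₁.toFun w) ≠ RBW.W := by rwa [hcolor, ← hvw, ← hcolor]
      rw [← (hsection v hv).2, ← (hsection w hw).2, hvw]
  refine Prod.ext ?_ (funext hcolor)
  funext v w
  exact propext ⟨hrel v w, hfib v w⟩

lemma bot_le_data (c : Contr T T') : ContrData.bot T ≤ c.data :=
  ⟨fun _ _ h => congrArg c.toFun h, c.color_back⟩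

end Contr

/-- The data for merging the vertex `u` with a set `K` of its children and giving the
resulting vertex the color `η`. -/
structure Collapse {S : Type} (T : RBWTree S) where
  u : T.V
  K : Set T.V
  η : RBW
  parent_eq : ∀ k ∈ K, T.parent k = u
  ne_root : ∀ k ∈ K, k ≠ T.root
  legal_below : ∀ v, v ∉ K → T.toLTree.strictAnc u v → RBW.legalPair (T.color v) η
  legal_above : ∀ w, T.toLTree.strictAnc w u → RBW.legalPair η (T.color w)
  color_back_self : (η = RBW.R → T.color u = RBW.R) ∧ (η = RBW.B → T.color u = RBW.B)
  color_back_child : ∀ k ∈ K, (η = RBW.R → T.color k = RBW.R) ∧ (η = RBW.B → T.color k = RBW.B)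
  arity : 2 ≤ {w | w ∉ K ∧ w ≠ T.root ∧ (T.parent w = u ∨ T.parent w ∈ K)}.ncard +
    (T.label u ∪ ⋃ k ∈ K, T.label k).ncard

namespace Collapse

open scoped Classical in
/-- The new color of a surviving vertex. -/
noncomputable def newColor {S : Type} {T : RBWTree S} (m : Collapse T) (v : T.V) : RBW :=
  if v = m.u then m.η else T.color v

variable {S : Type} {T T' : RBWTree S} (m : Collapse T)

lemma newColor_self : m.newColor m.u = m.η := if_pos rfl

lemma newColor_of_ne {v : T.V} (h : v ≠ m.u) : m.newColor v = T.color v := if_neg h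

lemma u_notMem : m.u ∉ m.K := fun h =>
  LTree.parent_ne_self (m.ne_root _ h) (m.parent_eq _ h)

lemma root_notMem : T.root ∉ m.K := fun h => m.ne_root _ h rfl

open scoped Classical in
/-- The collapsing map. -/
noncomputable def proj (v : T.V) : {v : T.V // v ∉ m.K} :=
  if h : v ∈ m.K then ⟨m.u, m.u_notMem⟩ else ⟨v, h⟩

lemma proj_of_mem {v : T.V} (h : v ∈ m.K) : m.proj v = ⟨m.u, m.u_notMem⟩ := dif_pos h

lemma proj_of_notMem {v : T.V} (h : v ∉ m.K) : m.proj v = ⟨v, h⟩ := dif_neg h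

lemma proj_val (x : {v : T.V // v ∉ m.K}) : m.proj x.1 = x := m.proj_of_notMem x.2

lemma proj_parent_of_mem {v : T.V} (h : v ∈ m.K) : m.proj (T.parent v) = m.proj v := by
  rw [m.parent_eq _ h, m.proj_of_mem h, m.proj_of_notMem]

lemma proj_eq_iff_of_ne {v w : T.V} (hw : w ∉ m.K) (hne : w ≠ m.u) :
    m.proj v = ⟨w, hw⟩ ↔ v = w := by
  by_cases hv : v ∈ m.K
  · rw [m.proj_of_mem hv, Subtype.mk.injEq]
    exact ⟨fun h => absurd h.symm hne, fun h => absurd (h ▸ hv) hw⟩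
  · rw [m.proj_of_notMem hv, Subtype.mk.injEq]

lemma proj_eq_u_iff {v : T.V} : m.proj v = ⟨m.u, m.u_notMem⟩ ↔ v = m.u ∨ v ∈ m.K := by
  by_cases hv : v ∈ m.K
  · simp [m.proj_of_mem hv, hv]
  · simp [m.proj_of_notMem hv, hv]

lemma ancOrEq_proj (v : T.V) : T.toLTree.ancOrEq (m.proj v).1 v := by
  by_cases hv : v ∈ m.K
  · rw [m.proj_of_mem hv]
    exact ⟨1, m.parent_eq _ hv⟩
  · rw [m.proj_of_notMem hv]
    exact LTree.ancOrEq_refl v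

lemma exists_iterate_proj (n : ℕ) (v : T.V) :
    ∃ k, (fun x : {v : T.V // v ∉ m.K} => m.proj (T.parent x.1))^[k] (m.proj v) =
      m.proj (T.parent^[n] v) := by
  induction n generalizing v with
  | zero => exact ⟨0, rfl⟩
  | succ n ih =>
    obtain ⟨k, hk⟩ := ih (T.parent v)
    by_cases hv : v ∈ m.K
    · rw [m.proj_parent_of_mem hv] at hk
      exact ⟨k, hk⟩
    · refine ⟨k + 1, ?_⟩
      rw [Function.iterate_succ_apply, m.proj_of_notMem hv]
      exact hk

lemma ncard_children (x : {v : T.V // v ∉ m.K}) :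
    {w : {v : T.V // v ∉ m.K} | m.proj (T.parent w.1) = x ∧ w ≠ m.proj T.root}.ncard =
      {w | w ∉ m.K ∧ w ≠ T.root ∧ m.proj (T.parent w) = x}.ncard := by
  rw [← Set.ncard_image_of_injective _ Subtype.val_injective]
  congr 1
  ext w
  simp only [Set.mem_image, Set.mem_ofPred_eq, m.proj_of_notMem m.root_notMem]
  constructor
  · rintro ⟨y, ⟨h1, h2⟩, rfl⟩
    exact ⟨y.2, fun h => h2 (Subtype.ext h), h1⟩
  · rintro ⟨hw, h1, h2⟩
    exact ⟨⟨w, hw⟩, ⟨h2, fun h => h1 (congrArg Subtype.val h)⟩, rfl⟩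

/-- The labeled tree obtained by collapsing. -/
noncomputable def lTree : LTree S where
  V := {v : T.V // v ∉ m.K}
  fintypeV := Fintype.ofFinite _
  root := m.proj T.root
  parent x := m.proj (T.parent x.1)
  parent_root := by rw [m.proj_of_notMem m.root_notMem, T.parent_root, m.proj_of_notMem]
  reaches_root x := by
    obtain ⟨n, hn⟩ := T.reaches_root x.1
    obtain ⟨k, hk⟩ := m.exists_iterate_proj n x.1
    rw [m.proj_val, hn] at hk
    exact ⟨k, hk⟩
  label x := ⋃ w ∈ {w | m.proj w = x}, T.label w
  label_disjoint x y hxy := by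
    simp only [Set.disjoint_iUnion_left, Set.disjoint_iUnion_right, Set.mem_ofPred_eq]
    rintro v hv w hw
    refine T.label_disjoint w v ?_
    rintro rfl
    exact hxy (hw.symm.trans hv)
  label_cover s := by
    obtain ⟨v, hv⟩ := T.label_cover s
    exact ⟨m.proj v, Set.mem_biUnion (by simp) hv⟩
  arity x := by
    rw [m.ncard_children]
    obtain ⟨x, hx⟩ := x
    by_cases hxu : x = m.u
    · subst hxu
      simp only [m.proj_eq_u_iff]
      have hl : ⋃ w ∈ {w | w = m.u ∨ w ∈ m.K}, T.label w =
          T.label m.u ∪ ⋃ k ∈ m.K, T.label k := by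
        ext s
        simp
      rw [hl]
      exact m.arity
    · simp only [m.proj_eq_iff_of_ne hx hxu]
      have hl : ⋃ w ∈ {w | w = x}, T.label w = T.label x := by simp
      have hc : {w | w ∉ m.K ∧ w ≠ T.root ∧ T.parent w = x} =
          {w | T.parent w = x ∧ w ≠ T.root} := by
        ext w
        constructor
        · exact fun h => ⟨h.2.2, h.2.1⟩
        · exact fun h => ⟨fun hw => hxu (h.1.symm.trans (m.parent_eq _ hw)), h.2, h.1⟩
      rw [hl, hc]
      exact T.arity x

lemma ancOrEq_of_lTree {x y : m.lTree.V} (h : m.lTree.ancOrEq x y) :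
    T.toLTree.ancOrEq x.1 y.1 := by
  obtain ⟨n, hn⟩ := h
  induction n generalizing y with
  | zero => exact ⟨0, by rw [← hn]; rfl⟩
  | succ n ih =>
    exact ((ih hn).trans (m.ancOrEq_proj _)).trans (LTree.ancOrEq_parent _)

/-- The RBW-tree obtained by collapsing. -/
noncomputable def tree : RBWTree S where
  toLTree := m.lTree
  color x := m.newColor x.1
  legal v w h := by
    have hs : T.toLTree.strictAnc w.1 v.1 :=
      ⟨m.ancOrEq_of_lTree h.1, fun h' => h.2 (Subtype.ext h')⟩
    by_cases hw : w.1 = m.u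
    · rw [hw, m.newColor_self, m.newColor_of_ne fun h' => hs.2 (hw.trans h'.symm)]
      exact m.legal_below _ v.2 (hw ▸ hs)
    · rw [m.newColor_of_ne hw]
      by_cases hv : v.1 = m.u
      · rw [hv, m.newColor_self]
        exact m.legal_above _ (hv ▸ hs)
      · rw [m.newColor_of_ne hv]
        exact T.legal _ _ hs

/-- The contraction onto the collapsed tree. -/
noncomputable def contr : Contr T m.tree where
  toFun := m.proj
  surj x := ⟨x.1, m.proj_val x⟩
  root_eq := rfl
  parent_compat v := by
    by_cases hv : v ∈ m.K
    · exact Or.inl (m.proj_parent_of_mem hv)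
    · refine Or.inr ?_
      change _ = m.proj (T.parent (m.proj v).1)
      rw [m.proj_of_notMem hv]
  fiber_subtree x := by
    refine ⟨x.1, m.proj_val x, fun w hw => ?_, fun w hw => ?_⟩
    · rw [← hw]
      exact m.ancOrEq_proj w
    · by_cases h : w ∈ m.K
      · exact Or.inr ((m.proj_parent_of_mem h).trans hw)
      · rw [m.proj_of_notMem h] at hw
        exact Or.inl (congrArg Subtype.val hw)
  label_eq _ := rfl
  color_back v := by
    change (m.newColor (m.proj v).1 = _ → _) ∧ (m.newColor (m.proj v).1 = _ → _)
    by_cases hv : v ∈ m.K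
    · rw [m.proj_of_mem hv, m.newColor_self]
      exact m.color_back_child v hv
    · rw [m.proj_of_notMem hv]
      by_cases hvu : v = m.u
      · subst hvu
        rw [m.newColor_self]
        exact m.color_back_self
      · rw [m.newColor_of_ne hvu]
        exact ⟨id, id⟩

lemma apply_proj (c : Contr T T') (hK : ∀ k ∈ m.K, c.toFun k = c.toFun m.u) (v : T.V) :
    c.toFun (m.proj v).1 = c.toFun v := by
  by_cases hv : v ∈ m.K
  · rw [m.proj_of_mem hv, hK v hv]
  · rw [m.proj_of_notMem hv]

/-- The contraction out of the collapsed tree induced by a contraction that is constant on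
the collapsed part. -/
noncomputable def desc (c : Contr T T') (hK : ∀ k ∈ m.K, c.toFun k = c.toFun m.u)
    (hη : (T'.color (c.toFun m.u) = RBW.R → m.η = RBW.R) ∧
      (T'.color (c.toFun m.u) = RBW.B → m.η = RBW.B)) : Contr m.tree T' where
  toFun x := c.toFun x.1
  surj y := by
    obtain ⟨v, rfl⟩ := c.surj y
    exact ⟨m.proj v, m.apply_proj c hK v⟩
  root_eq := (m.apply_proj c hK _).trans c.root_eq
  parent_compat x := by
    change c.toFun (m.proj (T.parent x.1)).1 = _ ∨ c.toFun (m.proj (T.parent x.1)).1 = _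
    rw [m.apply_proj c hK]
    exact c.parent_compat x.1
  fiber_subtree y := by
    obtain ⟨r, hr, hanc, hpar⟩ := c.fiber_subtree y
    refine ⟨m.proj r, (m.apply_proj c hK r).trans hr, fun x hx => ?_, fun x hx => ?_⟩
    · have := m.contr.map_ancOrEq (hanc x.1 hx)
      have hx' : m.contr.toFun x.1 = x := m.proj_val x
      rwa [hx'] at this
    · refine (hpar x.1 hx).imp (fun h => ?_) fun h => (m.apply_proj c hK _).trans h
      rw [← h]
      exact (m.proj_val x).symm
  label_eq y := by
    rw [c.label_eq]
    ext s
    simp only [Set.mem_iUnion, Set.mem_ofPred_eq]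
    constructor
    · rintro ⟨w, hw, hs⟩
      exact ⟨m.proj w, (m.apply_proj c hK w).trans hw, Set.mem_biUnion (by simp) hs⟩
    · rintro ⟨x, hx, hs⟩
      obtain ⟨w, hw, hs⟩ := Set.mem_iUnion₂.1 hs
      refine ⟨w, ?_, hs⟩
      rw [← m.apply_proj c hK w, show m.proj w = x from hw, hx]
  color_back x := by
    change (_ → m.newColor x.1 = _) ∧ (_ → m.newColor x.1 = _)
    by_cases hx : x.1 = m.u
    · rw [hx, m.newColor_self]
      exact hη
    · rw [m.newColor_of_ne hx]
      exact c.color_back x.1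

lemma codim_tree {x : T.V} (hx : T.color x ≠ RBW.W)
    (h : ∀ v, v ∉ m.K ∧ m.newColor v ≠ RBW.W ↔ T.color v ≠ RBW.W ∧ v ≠ x) :
    m.tree.codim + 1 = T.codim := by
  have h1 : m.tree.codim = ({v | T.color v ≠ RBW.W} \ {x}).ncard := by
    refine (Set.ncard_image_of_injective _ Subtype.val_injective).symm.trans ?_
    congr 1
    ext v
    simp only [Set.mem_sdiff, Set.mem_ofPred_eq, Set.mem_singleton_iff, ← h v]
    constructor
    · rintro ⟨y, hy, rfl⟩
      exact ⟨y.2, hy⟩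
    · rintro ⟨hv, hc⟩
      exact ⟨⟨v, hv⟩, hc, rfl⟩
  rw [h1]
  exact Set.ncard_sdiff_singleton_add_one hx (Set.toFinite _)

end Collapse

/-- A contraction that factors through a tree of codimension one less. -/
def Contr.HasStep {S : Type} {T T' : RBWTree S} (c : Contr T T') : Prop :=
  ∃ (T₁ : RBWTree S) (d : Contr T T₁) (e : Contr T₁ T'),
    (∀ v, e.toFun (d.toFun v) = c.toFun v) ∧ T₁.codim + 1 = T.codim

namespace Collapse

variable {S : Type} {T T' : RBWTree S} (m : Collapse T)

lemma hasStep (c : Contr T T') (hK : ∀ k ∈ m.K, c.toFun k = c.toFun m.u)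
    (hη : (T'.color (c.toFun m.u) = RBW.R → m.η = RBW.R) ∧
      (T'.color (c.toFun m.u) = RBW.B → m.η = RBW.B))
    {x : T.V} (hx : T.color x ≠ RBW.W)
    (h : ∀ v, v ∉ m.K ∧ m.newColor v ≠ RBW.W ↔ T.color v ≠ RBW.W ∧ v ≠ x) : c.HasStep :=
  ⟨m.tree, m.contr, m.desc c hK hη, m.apply_proj c hK, m.codim_tree hx h⟩

end Collapse

/-- A vertex of a labeled tree is inner if it has a child. -/
def LTree.IsInner {S : Type} (T : LTree S) (v : T.V) : Prop := ∃ w, T.parent w = v ∧ w ≠ T.root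

section arity

variable {S : Type} {T : LTree S} {u : T.V} {K : Set T.V}

lemma LTree.arity_collapse_of_finite (hK : ∀ k ∈ K, T.parent k = u ∧ k ≠ T.root)
    (h : K = ∅ ∨ (T.label u ∪ ⋃ k ∈ K, T.label k).Finite) :
    2 ≤ {w | w ∉ K ∧ w ≠ T.root ∧ (T.parent w = u ∨ T.parent w ∈ K)}.ncard +
      (T.label u ∪ ⋃ k ∈ K, T.label k).ncard := by
  rcases K.eq_empty_or_nonempty with rfl | ⟨k, hk⟩
  · simpa [and_comm] using T.arity u
  · have hfin : (T.label u ∪ ⋃ k ∈ K, T.label k).Finite :=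
      h.resolve_left fun h' => by simp [h'] at hk
    refine (T.arity k).trans (add_le_add (Set.ncard_le_ncard ?_ (Set.toFinite _))
      (Set.ncard_le_ncard ?_ hfin))
    · rintro w ⟨hw, hwr⟩
      refine ⟨fun hwK => ?_, hwr, Or.inr (hw ▸ hk)⟩
      have h1 := (hK w hwK).1
      have h2 := (hK k hk).1
      rw [hw] at h1
      exact LTree.parent_ne_self (hK k hk).2 (h2.trans h1.symm)
    · exact fun s hs => Or.inr (Set.mem_biUnion hk hs)

lemma LTree.arity_collapse_of_isInner {k : T.V} (hk : T.parent k = u ∧ k ≠ T.root)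
    (hinner : T.IsInner k) (hinf : ¬ (T.label u ∪ T.label k).Finite) :
    2 ≤ {w | w ≠ k ∧ w ≠ T.root ∧ (T.parent w = u ∨ T.parent w = k)}.ncard := by
  obtain ⟨z, hz, hzr⟩ := hinner
  have hne : u ≠ k := fun h => LTree.parent_ne_self hk.2 (hk.1.trans h)
  have hsub : ∀ w, T.parent w = k → w ≠ k := by
    rintro w hw rfl
    exact hne (hk.1.symm.trans hw)
  by_cases hlk : (T.label k).Finite
  · have hlu : (T.label u).Infinite := fun h => hinf (h.union hlk)
    have h2 := T.arity u
    rw [hlu.ncard, add_zero] at h2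
    obtain ⟨w, ⟨hw, hwr⟩, hwk⟩ := Set.exists_ne_of_one_lt_ncard h2 k
    refine (Set.one_lt_ncard (Set.toFinite _)).2 ⟨w, ⟨hwk, hwr, Or.inl hw⟩, z,
      ⟨hsub z hz, hzr, Or.inr hz⟩, ?_⟩
    rintro rfl
    exact hne (hw.symm.trans hz)
  · have h2 := T.arity k
    rw [Set.Infinite.ncard hlk, add_zero] at h2
    refine h2.trans (Set.ncard_le_ncard ?_ (Set.toFinite _))
    exact fun w hw => ⟨hsub w hw.1, hw.2, Or.inr hw.1⟩

end arity

lemma Contr.arity_collapse {S : Type} {T T' : RBWTree S} (c : Contr T T') {u : T.V}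
    {K : Set T.V} (hK : ∀ k ∈ K, c.toFun k = c.toFun u)
    (hinner : ∀ x, c.toFun x = c.toFun u → T.IsInner x → x = u ∨ x ∈ K)
    (hinf : ¬ (T.label u ∪ ⋃ k ∈ K, T.label k).Finite) :
    2 ≤ {w | w ∉ K ∧ w ≠ T.root ∧ (T.parent w = u ∨ T.parent w ∈ K)}.ncard := by
  have hl : (T'.label (c.toFun u)).Infinite := by
    refine Set.Infinite.mono ?_ hinf
    rw [c.label_eq]
    rintro s (hs | hs)
    · exact Set.mem_biUnion (by simp) hs
    · obtain ⟨k, hk, hs⟩ := Set.mem_iUnion₂.1 hs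
      exact Set.mem_biUnion (hK k hk) hs
  have h2 := T'.arity (c.toFun u)
  rw [hl.ncard, add_zero] at h2
  choose r hr hanc _ using c.fiber_subtree
  refine h2.trans (Set.ncard_le_ncard_of_injOn r ?_ ?_ (Set.toFinite _))
  · rintro y ⟨hy, hyr⟩
    have hrr : r y ≠ T.root := fun h => hyr (by rw [← hr y, h, c.root_eq])
    have hpar : c.toFun (T.parent (r y)) = c.toFun u := by
      rcases c.parent_compat (r y) with h | h
      · rw [hr] at h
        exact absurd (LTree.eq_root_of_ancOrEq_parent (hanc y _ h)) hrr
      · rw [h, hr, hy]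
    refine ⟨fun hyK => ?_, hrr, hinner _ hpar ⟨r y, rfl, hrr⟩⟩
    have := hK _ hyK
    rw [hr] at this
    exact LTree.parent_ne_self hyr (hy.trans this.symm)
  · intro y _ z _ hyz
    rw [← hr y, hyz, hr]

namespace Contr

variable {S : Type} {T T' : RBWTree S} (c : Contr T T')

lemma hasStep_merge {v : T.V} (hv : v ≠ T.root) (hc : c.toFun v = c.toFun (T.parent v))
    (hW : T.color v ≠ RBW.W) (hRB : ¬ (T.color v = RBW.R ∧ T.color (T.parent v) = RBW.B))
    (har : T.IsInner v ∨
      ∀ x, c.toFun x = c.toFun v → T.IsInner x → x = T.parent v ∨ x = v) : c.HasStep := by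
  have hl := T.legal_parent hv
  have hcol : (T.color (T.parent v) = RBW.R → T.color v = RBW.R) ∧
      (T.color (T.parent v) = RBW.B → T.color v = RBW.B) := by
    refine ⟨fun h => ?_, fun h => ?_⟩
    · rw [h] at hl
      exact hl.eq_R_of_R
    · cases h' : T.color v with
      | R => exact absurd ⟨h', h⟩ hRB
      | B => rfl
      | W => exact absurd h' hW
  let m : Collapse T :=
    { u := T.parent v
      K := {v}
      η := T.color (T.parent v)
      parent_eq := by rintro k rfl; rfl
      ne_root := by rintro k rfl; exact hv
      legal_below := fun w _ h => T.legal _ _ h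
      legal_above := fun w h => T.legal _ _ h
      color_back_self := ⟨id, id⟩
      color_back_child := by rintro k rfl; exact hcol
      arity := by
        by_cases hfin : (T.label (T.parent v) ∪ ⋃ k ∈ ({v} : Set T.V), T.label k).Finite
        · exact LTree.arity_collapse_of_finite (by rintro k rfl; exact ⟨rfl, hv⟩) (Or.inr hfin)
        · refine le_add_right ?_
          rcases har with har | har
          · exact LTree.arity_collapse_of_isInner ⟨rfl, hv⟩ har (by simpa using hfin)
          · refine c.arity_collapse ?_ (fun x hx => har x (hx.trans hc.symm)) hfin
            rintro k rfl
            exact hc }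
  refine m.hasStep c (fun k hk => (congrArg c.toFun hk).trans hc) (c.color_back _) hW fun w => ?_
  have : m.newColor w = T.color w := by
    by_cases h : w = m.u
    · rw [h]
      exact m.newColor_self
    · exact m.newColor_of_ne h
  rw [this, and_comm]
  rfl

lemma hasStep_recolor {v : T.V} (hc : T'.color (c.toFun v) = RBW.W) (hR : T.color v = RBW.R)
    (hv : v = T.root ∨ T.color (T.parent v) = RBW.B) : c.HasStep := by
  let m : Collapse T :=
    { u := v
      K := ∅
      η := RBW.W
      parent_eq := by simp
      ne_root := by simp
      legal_below := fun w _ h => by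
        have := T.legal _ _ h
        rw [hR] at this
        rw [this.eq_R_of_R]
        trivial
      legal_above := fun w h => by
        rw [RBWTree.color_eq_B_of_strictAnc hv h]
        trivial
      color_back_self := by simp
      color_back_child := by simp
      arity := LTree.arity_collapse_of_finite (by simp) (Or.inl rfl) }
  refine m.hasStep c (by simp [m]) (by simp [m, hc]) (x := v) (by simp [hR]) fun w => ?_
  by_cases h : w = v
  · subst h
    simp [m, Collapse.newColor]
  · simp [m, Collapse.newColor, h]

lemma hasStep_absorb {u : T.V} (hc : T'.color (c.toFun u) = RBW.W) (hB : T.color u = RBW.B)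
    (hch : ∀ k, T.parent k = u → k ≠ T.root → T.color k ≠ RBW.B)
    (har : (∀ k, T.parent k = u → k ≠ T.root → T.color k ≠ RBW.W) ∨
      ∀ x, c.toFun x = c.toFun u → T.IsInner x →
        x = u ∨ T.parent x = u ∧ x ≠ T.root ∧ T.color x = RBW.W) : c.HasStep := by
  have hfib : ∀ k, T.parent k = u → k ≠ T.root → T.color k = RBW.W →
      c.toFun k = c.toFun u := by
    rintro k rfl hk hkW
    by_contra hne
    have := c.legal_of_ne hne
    rw [hc] at this
    rw [(c.color_back k).1 this.eq_R_of_W] at hkW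
    exact absurd hkW (by simp)
  let K : Set T.V := {k | T.parent k = u ∧ k ≠ T.root ∧ T.color k = RBW.W}
  let m : Collapse T :=
    { u := u
      K := K
      η := RBW.W
      parent_eq := fun k hk => hk.1
      ne_root := fun k hk => hk.2.1
      legal_below := fun w hw h => by
        obtain ⟨k, hk, hkr, hkw⟩ := h.exists_child
        suffices T.color w = RBW.R by
          rw [this]
          trivial
        cases hcol : T.color k with
        | B => exact absurd hcol (hch k hk hkr)
        | R =>
          rcases hkw.eq_or_strictAnc with rfl | hs
          · exact hcol
          · have := T.legal _ _ hs
            rw [hcol] at this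
            exact this.eq_R_of_R
        | W =>
          rcases hkw.eq_or_strictAnc with rfl | hs
          · exact absurd ⟨hk, hkr, hcol⟩ hw
          · have := T.legal _ _ hs
            rw [hcol] at this
            exact this.eq_R_of_W
      legal_above := fun w h => by
        have := T.legal _ _ h
        rw [hB] at this
        rw [this.eq_B_of_B]
        trivial
      color_back_self := by simp
      color_back_child := by simp
      arity := by
        have hK : ∀ k ∈ K, T.parent k = u ∧ k ≠ T.root := fun k hk => ⟨hk.1, hk.2.1⟩
        by_cases hfin : (T.label u ∪ ⋃ k ∈ K, T.label k).Finite
        · exact LTree.arity_collapse_of_finite hK (Or.inr hfin)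
        · rcases har with har | har
          · refine LTree.arity_collapse_of_finite hK (Or.inl ?_)
            exact Set.eq_empty_of_forall_notMem fun k hk => har k hk.1 hk.2.1 hk.2.2
          · exact le_add_right
              (c.arity_collapse (fun k hk => hfib k hk.1 hk.2.1 hk.2.2) har hfin) }
  refine m.hasStep c (fun k hk => hfib k hk.1 hk.2.1 hk.2.2) (by simp [m, hc]) (x := u)
    (by simp [hB]) fun w => ?_
  by_cases h : w = u
  · subst h
    simp [m, Collapse.newColor]
  · rw [m.newColor_of_ne h]
    constructor
    · exact fun hw => ⟨hw.2, h⟩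
    · exact fun hw => ⟨fun hk => hw.1 hk.2.2, hw.1⟩

/-- A contraction that changes the codimension factors through a tree of codimension one
less. -/
lemma hasStep_of_codim_ne (h : T.codim ≠ T'.codim) : c.HasStep := by
  by_contra hno
  have hleafB : ∀ v, v ≠ T.root → c.toFun v = c.toFun (T.parent v) → T.color v ≠ RBW.W →
      ¬ (T.color v = RBW.R ∧ T.color (T.parent v) = RBW.B) → ¬ T.IsInner v :=
    fun v hv hcv hW hRB hin => hno (c.hasStep_merge hv hcv hW hRB (Or.inl hin))
  -- vertices of color `B` with an image of color `W` can be absorbed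
  have hnoB : ∀ u, T'.color (c.toFun u) = RBW.W → T.color u ≠ RBW.B := by
    intro u hcu hB
    have hleaf : ∀ v, T'.color (c.toFun v) = RBW.W → T.color v = RBW.B → T.IsInner v := by
      intro v hcv hvB
      by_contra hin
      exact hno (c.hasStep_absorb hcv hvB (fun k hk hkr => absurd ⟨k, hk, hkr⟩ hin)
        (Or.inl fun k hk hkr => absurd ⟨k, hk, hkr⟩ hin))
    have hparB : ∀ v, v ≠ T.root → c.toFun v = c.toFun (T.parent v) →
        T'.color (c.toFun v) = RBW.W → T.color v ≠ RBW.B := fun v hv hcv hvW hvB =>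
      hleafB v hv hcv (by simp [hvB]) (by simp [hvB]) (hleaf v hvW hvB)
    obtain ⟨r, hr, hanc, hpar⟩ := c.fiber_subtree (c.toFun u)
    have hfib : ∀ x, c.toFun x = c.toFun u → x ≠ r →
        x ≠ T.root ∧ c.toFun x = c.toFun (T.parent x) := by
      intro x hx
      refine c.parent_mem_fiber ?_ ?_ (hx.trans hr.symm) <;> rw [hr] <;> assumption
    have hur : ∀ x, c.toFun x = c.toFun u → T.color x = RBW.B → x = r := by
      intro x hx hxB
      by_contra hxr
      exact hparB x (hfib x hx hxr).1 (hfib x hx hxr).2 (by rw [hx, hcu]) hxB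
    have hu := hur u rfl hB
    refine hno (c.hasStep_absorb hcu hB ?_ (Or.inr ?_))
    · rintro k rfl hkr hkB
      have hck : c.toFun k = c.toFun (T.parent k) := by
        by_contra hne
        have := c.legal_of_ne hne
        rw [hcu] at this
        rw [(c.color_back k).1 this.eq_R_of_W] at hkB
        exact absurd hkB (by simp)
      exact hparB k hkr hck (by rw [hck, hcu]) hkB
    · intro x hx hin
      by_cases hxu : x = u
      · exact Or.inl hxu
      obtain ⟨hxr, hxp⟩ := hfib x hx (hu ▸ hxu)
      have hRB : ¬ (T.color x = RBW.R ∧ T.color (T.parent x) = RBW.B) := fun h' =>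
        hno (c.hasStep_recolor (by rw [hx, hcu]) h'.1 (Or.inr h'.2))
      have hxW : T.color x = RBW.W := by
        by_contra hxW
        exact hleafB x hxr hxp hxW hRB hin
      have hpB := T.legal_parent hxr
      rw [hxW] at hpB
      refine Or.inr ⟨?_, hxr, hxW⟩
      rw [hur _ (hxp.symm.trans hx) hpB.eq_B_of_W, hu]
  -- the remaining edges inside fibers can be contracted
  have hedge : ∀ v, v ≠ T.root → c.toFun v = c.toFun (T.parent v) →
      T.color v ≠ RBW.W ∧ ¬ (T.color v = RBW.R ∧ T.color (T.parent v) = RBW.B) := by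
    intro v hv hcv
    refine ⟨fun hvW => ?_, fun hRB => ?_⟩
    · have hl := T.legal_parent hv
      rw [hvW] at hl
      refine hnoB (T.parent v) ?_ hl.eq_B_of_W
      rw [← hcv]
      cases hcol : T'.color (c.toFun v) with
      | R => exact absurd ((c.color_back v).1 hcol) (by simp [hvW])
      | B => exact absurd ((c.color_back v).2 hcol) (by simp [hvW])
      | W => rfl
    · refine hnoB (T.parent v) ?_ hRB.2
      cases hcol : T'.color (c.toFun (T.parent v)) with
      | R => exact absurd ((c.color_back _).1 hcol) (by simp [hRB.2])
      | B => exact absurd ((c.color_back v).2 (hcv ▸ hcol)) (by simp [hRB.1])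
      | W => rfl
  have hnoedge : ∀ v, v ≠ T.root → c.toFun v ≠ c.toFun (T.parent v) := by
    intro v hv hcv
    obtain ⟨r, hr, hanc, hpar⟩ := c.fiber_subtree (c.toFun v)
    have hinner : ∀ x, c.toFun x = c.toFun v → T.IsInner x → x = r := by
      intro x hx hin
      by_contra hxr
      obtain ⟨hxr, hxp⟩ := c.parent_mem_fiber (r := r) (by rwa [hr]) (by rwa [hr])
        (hx.trans hr.symm) hxr
      exact hleafB x hxr hxp (hedge x hxr hxp).1 (hedge x hxr hxp).2 hin
    refine hno (c.hasStep_merge hv hcv (hedge v hv hcv).1 (hedge v hv hcv).2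
      (Or.inr fun x hx hin => Or.inl ?_))
    rw [hinner x hx hin, hinner _ hcv.symm ⟨v, rfl, hv⟩]
  have hinj : Function.Injective c.toFun := by
    intro v w hvw
    obtain ⟨r, hr, hanc, hpar⟩ := c.fiber_subtree (c.toFun w)
    have key : ∀ x, c.toFun x = c.toFun w → x = r := by
      intro x hx
      by_contra hxr
      obtain ⟨hxr, hxp⟩ := c.parent_mem_fiber (r := r) (by rwa [hr]) (by rwa [hr])
        (hx.trans hr.symm) hxr
      exact hnoedge x hxr hxp
    rw [key v hvw, key w rfl]
  have hcolor : ∀ v, T.color v ≠ RBW.W → T'.color (c.toFun v) ≠ RBW.W := by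
    intro v hv hcv
    cases hcol : T.color v with
    | W => exact hv hcol
    | B => exact hnoB v hcv hcol
    | R =>
      refine hno (c.hasStep_recolor hcv hcol ?_)
      by_cases hvr : v = T.root
      · exact Or.inl hvr
      · have := c.legal_of_ne (hnoedge v hvr)
        rw [hcv] at this
        exact Or.inr ((c.color_back _).2 this.eq_B_of_W)
  refine h ?_
  rw [RBWTree.codim, RBWTree.codim, ← Set.ncard_image_of_injective _ hinj]
  congr 1
  ext y
  constructor
  · rintro ⟨v, hv, rfl⟩
    exact hcolor v hv
  · obtain ⟨v, rfl⟩ := c.surj y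
    refine fun hy => ⟨v, fun hv => hy ?_, rfl⟩
    cases hcol : T'.color (c.toFun v) with
    | R => exact absurd ((c.color_back v).1 hcol) (by simp [hv])
    | B => exact absurd ((c.color_back v).2 hcol) (by simp [hv])
    | W => rfl

lemma codim_le (c : Contr T T') : T'.codim ≤ T.codim :=
  ((refl T).codim_le_and_eq c c.bot_le_data).1

lemma data_ne_bot (h : T'.codim < T.codim) : c.data ≠ ContrData.bot T := fun hbot => by
  refine h.not_ge ((c.codim_le_and_eq (refl T) ?_).1)
  rw [hbot, refl_data]
  exact ⟨fun _ _ => id, fun _ => ⟨id, id⟩⟩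

/-- Precomposition of contraction data with a contraction. -/
def pull {T₁ : RBWTree S} (d : Contr T T₁) (q : ContrData T₁) : ContrData T :=
  (fun v w => q.1 (d.toFun v) (d.toFun w), fun v => q.2 (d.toFun v))

lemma pull_injective {T₁ : RBWTree S} (d : Contr T T₁) : Function.Injective d.pull := by
  intro q q' h
  have h1 := congrArg Prod.fst h
  have h2 := congrArg Prod.snd h
  refine Prod.ext ?_ ?_
  · funext x y
    obtain ⟨v, rfl⟩ := d.surj x
    obtain ⟨w, rfl⟩ := d.surj y
    exact congrFun (congrFun h1 v) w
  · funext x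
    obtain ⟨v, rfl⟩ := d.surj x
    exact congrFun h2 v

lemma pull_mono {T₁ : RBWTree S} (d : Contr T T₁) {q q' : ContrData T₁} (h : q ≤ q') :
    d.pull q ≤ d.pull q' :=
  ⟨fun _ _ => h.1 _ _, fun _ => h.2 _⟩

lemma exists_chain (n : ℕ) : ∀ {T : RBWTree S} (c : Contr T T'), T.codim = n →
    ∃ C : Set (Pcal c.data), C.Finite ∧ IsChain (· ≤ ·) C ∧ C.ncard = T.codim - T'.codim := by
  induction n with
  | zero =>
    intro T c hT
    exact ⟨∅, Set.finite_empty, IsChain.empty, by simp [hT]⟩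
  | succ n ih =>
    intro T c hT
    by_cases hne : T.codim = T'.codim
    · exact ⟨∅, Set.finite_empty, IsChain.empty, by simp [hne]⟩
    obtain ⟨T₁, d, e, hcomp, hcodim⟩ := c.hasStep_of_codim_ne hne
    obtain ⟨C, hfin, hchain, hcard⟩ := ih e (by omega)
    have hdata : c.data = d.pull e.data := by
      refine Prod.ext ?_ ?_
      · funext v w
        change (c.toFun v = c.toFun w) = (e.toFun (d.toFun v) = e.toFun (d.toFun w))
        rw [hcomp, hcomp]
      · funext v
        change T'.color (c.toFun v) = T'.color (e.toFun (d.toFun v))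
        rw [hcomp]
    have hpull : ∀ q : Pcal e.data, (d.pull q.1).Realizable ∧ d.pull q.1 ≠ ContrData.bot T ∧
        d.pull q.1 ≤ c.data := by
      rintro ⟨q, ⟨T₂, f, rfl⟩, _, hle⟩
      refine ⟨⟨T₂, f.comp d, rfl⟩, (f.comp d).data_ne_bot ?_, hdata ▸ d.pull_mono hle⟩
      have := f.codim_le
      omega
    let φ : Pcal e.data → Pcal c.data := fun q => ⟨d.pull q.1, hpull q⟩
    have hφ : Function.Injective φ := fun q q' h =>
      Subtype.ext (d.pull_injective (congrArg Subtype.val h))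
    let q₀ : Pcal c.data := ⟨d.data, ⟨T₁, d, rfl⟩, d.data_ne_bot (by omega),
      hdata ▸ d.pull_mono e.bot_le_data⟩
    have hq₀ : q₀ ∉ φ '' C := by
      rintro ⟨q, _, hq⟩
      exact q.2.2.1 (d.pull_injective (congrArg Subtype.val hq))
    refine ⟨insert q₀ (φ '' C), (hfin.image φ).insert _, ?_, ?_⟩
    · refine IsChain.insert (IsChain.image_of_map_rel _ _ φ (fun _ _ h => d.pull_mono h) hchain) ?_
      rintro _ ⟨⟨_, ⟨T₂, f, rfl⟩, _⟩, _, rfl⟩ _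
      exact Or.inl (d.pull_mono f.bot_le_data)
    · rw [Set.ncard_insert_of_notMem hq₀ (hfin.image φ), Set.ncard_image_of_injective _ hφ, hcard]
      have := e.codim_le
      omega

lemma chain_card_le (C : Set (Pcal c.data)) (hC : IsChain (· ≤ ·) C) :
    C.ncard ≤ T.codim - T'.codim := by
  choose X f hf using fun q : Pcal c.data => q.2.1
  have hcard : (Set.Ico T'.codim T.codim).ncard = T.codim - T'.codim := by
    rw [← Finset.coe_Ico, Set.ncard_coe_finset, Nat.card_Ico]
  rw [← hcard]
  have key : ∀ q q' : Pcal c.data, q ≤ q' → (X q).codim = (X q').codim → q = q' := by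
    intro q q' hle heq
    refine Subtype.ext ?_
    rw [← hf q, ← hf q']
    refine ((f q).codim_le_and_eq (f q') ?_).2 heq.le
    rw [hf, hf]
    exact hle
  refine Set.ncard_le_ncard_of_injOn (fun q => (X q).codim) ?_ ?_ (Set.finite_Ico _ _)
  · intro q _
    constructor
    · refine ((f q).codim_le_and_eq c ?_).1
      rw [hf]
      exact q.2.2.2
    · by_contra hlt
      refine q.2.2.1 ?_
      rw [← hf q, ← ((refl T).codim_le_and_eq (f q) (f q).bot_le_data).2 (not_lt.1 hlt), refl_data]
  · intro q hq q' hq' heq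
    by_contra hne
    rcases hC hq hq' hne with hle | hle
    · exact hne (key q q' hle heq)
    · exact hne (key q' q hle heq.symm).symm

end Contr


/-- for every RBW-contraction `𝔠 : T → T'`, the maximal length of a chain
in the poset `𝒫_𝔠` of nontrivial intermediate contractions is `codim(𝔠) − 1`; with
lengths shifted by one, the maximal cardinality of a chain is
`codim(𝔠) = Codim(T) − Codim(T')`. -/
theorem max_chain_card_eq_codim {S : Type} {T T' : RBWTree S} (c : Contr T T') :
    (∃ C : Set (Pcal c.data), IsChain (· ≤ ·) C ∧ C.ncard = T.codim - T'.codim) ∧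
    ∀ C : Set (Pcal c.data), IsChain (· ≤ ·) C → C.ncard ≤ T.codim - T'.codim := by
  obtain ⟨C, _, hC, hcard⟩ := c.exists_chain _ rfl
  exact ⟨⟨C, hC, hcard⟩, c.chain_card_le⟩
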